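/- arXiv:math/0506459 — 2 statements merged into one kernel-verified Lean document; each statement's English description precedes it below -/
import Mathlib

section
/- Let D ⊆ ℝⁿ be a domain containing the origin and f : ℝ × D → ℝⁿ satisfy: f(t,0)=0 for all t; f is uniformly continuous in t uniformly in x ∈ D; f is uniformly locally Lipschitz in x with a Lipschitz constant on each compact independent of t; and ‖f(t,x)‖ ≤ M(x) for all t for some continuous M : D → ℝ. Suppose there is a C¹ function V : D → ℝ with V ≥ 0 on D and V(0) = 0, a continuous W : D → ℝ with ∇V(x)·f(t,x) ≤ W(x) ≤ 0 for all (t,x), and that f restricted to E = {x ∈ D : W(x) = 0} is time-invariant. Let N be the maximal positively invariant set contained in E. If the origin is an asymptotically stable equilibrium of the dynamics restricted to N, then the origin is a uniformly stable equilibrium of ẋ = f(t,x); in particular, solutions starting sufficiently close to the origin are defined for all positive time. -/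
open Set Filter Metric Topology

/-- `x` solves the time-varying ODE `ẋ = f t x`, staying in the set `D`,
for every time in the time set `s`. -/
def IsSolOn {n : ℕ} (D : Set (EuclideanSpace ℝ (Fin n)))
    (f : ℝ → EuclideanSpace ℝ (Fin n) → EuclideanSpace ℝ (Fin n))
    (x : ℝ → EuclideanSpace ℝ (Fin n)) (s : Set ℝ) : Prop :=
  ∀ t ∈ s, x t ∈ D ∧ HasDerivAt x (f t (x t)) t

/-- `S` is positively invariant for the dynamics `ẋ = f t x` on `D`:
every solution (lying in `D`) starting in `S` stays in `S`. -/
def PosInvariant {n : ℕ} (D : Set (EuclideanSpace ℝ (Fin n)))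
    (f : ℝ → EuclideanSpace ℝ (Fin n) → EuclideanSpace ℝ (Fin n))
    (S : Set (EuclideanSpace ℝ (Fin n))) : Prop :=
  ∀ (t₀ t₁ : ℝ) (x : ℝ → EuclideanSpace ℝ (Fin n)),
    IsSolOn D f x (Icc t₀ t₁) → x t₀ ∈ S → ∀ t ∈ Icc t₀ t₁, x t ∈ S

/-- The maximal positively invariant subset of `E` for the dynamics `ẋ = f t x` on `D`. -/
def MaxPosInv {n : ℕ} (D : Set (EuclideanSpace ℝ (Fin n)))
    (f : ℝ → EuclideanSpace ℝ (Fin n) → EuclideanSpace ℝ (Fin n))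
    (E : Set (EuclideanSpace ℝ (Fin n))) : Set (EuclideanSpace ℝ (Fin n)) :=
  ⋃₀ {S | S ⊆ E ∧ PosInvariant D f S}

/-- The origin is a uniformly stable equilibrium of `ẋ = f t x` on `D`. -/
def UniformlyStable {n : ℕ} (D : Set (EuclideanSpace ℝ (Fin n)))
    (f : ℝ → EuclideanSpace ℝ (Fin n) → EuclideanSpace ℝ (Fin n)) : Prop :=
  ∀ ε > 0, ∃ δ > 0, ∀ t₀ : ℝ, ∀ x₀ ∈ D, ‖x₀‖ < δ →
    ∃ x : ℝ → EuclideanSpace ℝ (Fin n), x t₀ = x₀ ∧ IsSolOn D f x (Ici t₀) ∧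
      ∀ t > t₀, ‖x t‖ < ε

/-- The origin is a uniformly asymptotically stable equilibrium of `ẋ = f t x` on `D`. -/
def UniformlyAsympStable {n : ℕ} (D : Set (EuclideanSpace ℝ (Fin n)))
    (f : ℝ → EuclideanSpace ℝ (Fin n) → EuclideanSpace ℝ (Fin n)) : Prop :=
  UniformlyStable D f ∧ ∃ δ > 0, ∀ t₀ : ℝ, ∀ x₀ ∈ D, ‖x₀‖ < δ →
    ∃ x : ℝ → EuclideanSpace ℝ (Fin n), x t₀ = x₀ ∧ IsSolOn D f x (Ici t₀) ∧
      Tendsto x atTop (𝓝 0)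

/-- The origin is a (possibly non-uniformly) stable equilibrium of the dynamics
`ẋ = f t x` restricted to the set `N`. -/
def StableOn {n : ℕ} (N : Set (EuclideanSpace ℝ (Fin n)))
    (f : ℝ → EuclideanSpace ℝ (Fin n) → EuclideanSpace ℝ (Fin n)) : Prop :=
  ∀ t₀ : ℝ, ∀ ε > 0, ∃ δ > 0, ∀ x₀ ∈ N, ‖x₀‖ < δ →
    ∃ x : ℝ → EuclideanSpace ℝ (Fin n), x t₀ = x₀ ∧ IsSolOn N f x (Ici t₀) ∧
      ∀ t > t₀, ‖x t‖ < ε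

/-- The origin is an asymptotically stable equilibrium of the dynamics
`ẋ = f t x` restricted to the set `N`. -/
def AsympStableOn {n : ℕ} (N : Set (EuclideanSpace ℝ (Fin n)))
    (f : ℝ → EuclideanSpace ℝ (Fin n) → EuclideanSpace ℝ (Fin n)) : Prop :=
  StableOn N f ∧ ∀ t₀ : ℝ, ∃ δ > 0, ∀ x₀ ∈ N, ‖x₀‖ < δ →
    ∃ x : ℝ → EuclideanSpace ℝ (Fin n), x t₀ = x₀ ∧ IsSolOn N f x (Ici t₀) ∧
      Tendsto x atTop (𝓝 0)

/-- A Lipschitz nearest-point retraction onto a nonempty complete convex set. -/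
lemma exists_lipschitz_retraction {E : Type*} [NormedAddCommGroup E] [InnerProductSpace ℝ E]
    {K : Set E} (hne : K.Nonempty) (hcomplete : IsComplete K) (hconvex : Convex ℝ K) :
    ∃ P : E → E, LipschitzWith 1 P ∧ (∀ x, P x ∈ K) ∧ ∀ x ∈ K, P x = x := by
  have hP : ∀ u : E, ∃ v ∈ K, ∀ w ∈ K, inner ℝ (u - v) (w - v) ≤ 0 := by
    intro u
    obtain ⟨v, hv, h⟩ := exists_norm_eq_iInf_of_complete_convex hne hcomplete hconvex u
    exact ⟨v, hv, (norm_eq_iInf_iff_real_inner_le_zero hconvex hv).1 h⟩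
  choose P hPK hPin using hP
  refine ⟨P, LipschitzWith.of_dist_le_mul fun x y ↦ ?_, hPK, fun x hx ↦ ?_⟩
  · have h₁ := hPin x (P y) (hPK y)
    have h₂ := hPin y (P x) (hPK x)
    have h₃ : ‖P x - P y‖ ^ 2 ≤ inner ℝ (x - y) (P x - P y) := by
      rw [← real_inner_self_eq_norm_sq]
      simp only [inner_sub_left, inner_sub_right] at h₁ h₂ ⊢
      linarith
    have h₄ := real_inner_le_norm (x - y) (P x - P y)
    rw [dist_eq_norm, dist_eq_norm, NNReal.coe_one, one_mul]
    by_contra! hlt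
    nlinarith [norm_nonneg (x - y)]
  · have h := hPin x x hx
    rw [real_inner_self_eq_norm_sq] at h
    have : ‖x - P x‖ = 0 := by nlinarith [norm_nonneg (x - P x)]
    exact (sub_eq_zero.1 (norm_eq_zero.1 this)).symm

/-- A bounded vector field that is globally Lipschitz in space and continuous in time has
global solutions. -/
lemma exists_global_solution {E : Type*} [NormedAddCommGroup E] [NormedSpace ℝ E]
    [CompleteSpace E] {g : ℝ → E → E} {K C : NNReal} (hlip : ∀ t, LipschitzWith K (g t))
    (hcont : ∀ x, Continuous fun t ↦ g t x) (hbdd : ∀ t x, ‖g t x‖ ≤ C) (t₀ : ℝ) (x₀ : E) :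
    ∃ x : ℝ → E, x t₀ = x₀ ∧ ∀ t, HasDerivAt x (g t (x t)) t := by
  have hloc : ∀ k : ℕ, ∃ α : ℝ → E, α t₀ = x₀ ∧
      ∀ t ∈ Ioo (t₀ - k) (t₀ + k), HasDerivAt α (g t (α t)) t := by
    intro k
    have hpl : IsPicardLindelof g (tmin := t₀ - k) (tmax := t₀ + k)
        ⟨t₀, by simp⟩ x₀ (C * k) 0 C K :=
      { lipschitzOnWith := fun t _ ↦ (hlip t).lipschitzOnWith
        continuousOn := fun x _ ↦ (hcont x).continuousOn
        norm_le := fun t _ x _ ↦ hbdd t x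
        mul_max_le := by simp }
    obtain ⟨α, h₀, h⟩ := hpl.exists_eq_forall_mem_Icc_hasDerivWithinAt₀
    exact ⟨α, h₀, fun t ht ↦
      (h t (Ioo_subset_Icc_self ht)).hasDerivAt (Icc_mem_nhds ht.1 ht.2)⟩
  choose α hα₀ hα using hloc
  have hagree : ∀ (j k : ℕ) (s : ℝ), |s - t₀| < j → |s - t₀| < k → α j s = α k s := by
    intro j k s hj hk
    have hpos : 0 < min (j : ℝ) k := lt_min ((abs_nonneg _).trans_lt hj) ((abs_nonneg _).trans_lt hk)
    have hs := abs_lt.1 (lt_min hj hk)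
    have hsub : ∀ t ∈ Ioo (t₀ - min (j : ℝ) k) (t₀ + min (j : ℝ) k),
        t ∈ Ioo (t₀ - j) (t₀ + j) ∧ t ∈ Ioo (t₀ - k) (t₀ + k) := by
      intro t ht
      have h₁ := min_le_left (j : ℝ) k
      have h₂ := min_le_right (j : ℝ) k
      exact ⟨⟨by linarith [ht.1], by linarith [ht.2]⟩, ⟨by linarith [ht.1], by linarith [ht.2]⟩⟩
    exact ODE_solution_unique_of_mem_Ioo (v := g) (s := fun _ ↦ univ)
      (fun t _ ↦ (hlip t).lipschitzOnWith)
      (a := t₀ - min (j : ℝ) k) (b := t₀ + min (j : ℝ) k) (t₀ := t₀)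
      ⟨by linarith, by linarith⟩
      (fun t ht ↦ ⟨hα j t (hsub t ht).1, mem_univ _⟩)
      (fun t ht ↦ ⟨hα k t (hsub t ht).2, mem_univ _⟩)
      ((hα₀ j).trans (hα₀ k).symm) ⟨by linarith [hs.1], by linarith [hs.2]⟩
  set x : ℝ → E := fun t ↦ α (⌊|t - t₀|⌋₊ + 1) t with hx
  have hxα : ∀ (k : ℕ) (s : ℝ), |s - t₀| < k → x s = α k s := fun k s hk ↦
    hagree _ k s (by push_cast; exact Nat.lt_floor_add_one _) hk
  refine ⟨x, hα₀ _, fun t ↦ ?_⟩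
  obtain ⟨k, hk⟩ := exists_nat_gt |t - t₀|
  have hev : x =ᶠ[𝓝 t] α k := by
    have : ∀ᶠ s in 𝓝 t, |s - t₀| < k :=
      (by fun_prop : Continuous fun s : ℝ ↦ |s - t₀|).continuousAt.eventually_lt_const hk
    exact this.mono fun s hs ↦ hxα k s hs
  rw [hxα k t hk]
  have := abs_lt.1 hk
  exact (hα k t ⟨by linarith [this.1], by linarith [this.2]⟩).congr_of_eventuallyEq hev

section

variable {n : ℕ} {D S N : Set (EuclideanSpace ℝ (Fin n))}
  {f : ℝ → EuclideanSpace ℝ (Fin n) → EuclideanSpace ℝ (Fin n)}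
  {x y : ℝ → EuclideanSpace ℝ (Fin n)}

lemma IsSolOn.mono {s s' : Set ℝ} (h : IsSolOn D f x s) (hD : D ⊆ S) (hs : s' ⊆ s) :
    IsSolOn S f x s' :=
  fun t ht ↦ ⟨hD (h t (hs ht)).1, (h t (hs ht)).2⟩

lemma IsSolOn.continuousOn {s : Set ℝ} (h : IsSolOn D f x s) : ContinuousOn x s :=
  fun t ht ↦ (h t ht).2.continuousAt.continuousWithinAt

/-- Time translates of solutions in a region where the vector field is time-invariant. -/
lemma IsSolOn.translate (hinv : ∀ t t₀ : ℝ, ∀ z ∈ N, f t z = f t₀ z)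
    (h : IsSolOn N f x (Ici 0)) (a : ℝ) : IsSolOn N f (fun t ↦ x (t - a)) (Ici a) := by
  intro t ht
  have h' := h (t - a) (sub_nonneg.2 (mem_Ici.1 ht))
  refine ⟨h'.1, ?_⟩
  rw [hinv t (t - a) _ h'.1]
  exact h'.2.comp_sub_const t a

/-- Forward translates of solutions in a region where the vector field is time-invariant. -/
lemma IsSolOn.shift (hinv : ∀ t t₀ : ℝ, ∀ z ∈ N, f t z = f t₀ z)
    (h : IsSolOn N f x (Ici 0)) {a : ℝ} (ha : 0 ≤ a) :
    IsSolOn N f (fun t ↦ x (t + a)) (Ici 0) := by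
  intro t ht
  have h' := h (t + a) (add_nonneg ht ha)
  refine ⟨h'.1, ?_⟩
  rw [hinv t (t + a) _ h'.1]
  exact h'.2.comp_add_const t a

/-- Grönwall estimate for two solutions in a set where the field is uniformly Lipschitz. -/
lemma IsSolOn.norm_sub_le {L a b : ℝ} (hL : 0 < L)
    (hlip : ∀ t : ℝ, ∀ x ∈ S, ∀ y ∈ S, ‖f t x - f t y‖ ≤ L * ‖x - y‖)
    (hx : IsSolOn S f x (Icc a b)) (hy : IsSolOn S f y (Icc a b)) :
    ∀ t ∈ Icc a b, ‖x t - y t‖ ≤ ‖x a - y a‖ * Real.exp (L * (t - a)) := by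
  have h := dist_le_of_trajectories_ODE_of_mem (v := f) (s := fun _ ↦ S) (K := ⟨L, hL.le⟩)
    (fun t _ ↦ LipschitzOnWith.of_dist_le_mul fun u hu v hv ↦ by
      rw [dist_eq_norm, dist_eq_norm]
      exact hlip t u hu v hv)
    hx.continuousOn (fun t ht ↦ (hx t (Ico_subset_Icc_self ht)).2.hasDerivWithinAt)
    (fun t ht ↦ (hx t (Ico_subset_Icc_self ht)).1)
    hy.continuousOn (fun t ht ↦ (hy t (Ico_subset_Icc_self ht)).2.hasDerivWithinAt)
    (fun t ht ↦ (hy t (Ico_subset_Icc_self ht)).1) le_rfl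
  simp only [dist_eq_norm] at h
  exact h

/-- Uniqueness of solutions of a locally Lipschitz differential equation. -/
lemma IsSolOn.eq_of_eq
    (hf_lip : ∀ K : Set (EuclideanSpace ℝ (Fin n)), K ⊆ D → IsCompact K →
      ∃ L > (0 : ℝ), ∀ t : ℝ, ∀ x ∈ K, ∀ y ∈ K, ‖f t x - f t y‖ ≤ L * ‖x - y‖)
    {a b : ℝ} (hx : IsSolOn D f x (Icc a b)) (hy : IsSolOn D f y (Icc a b)) (h : x a = y a) :
    ∀ t ∈ Icc a b, x t = y t := by
  obtain ⟨L, hL, hlip⟩ := hf_lip (x '' Icc a b ∪ y '' Icc a b)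
    (union_subset (image_subset_iff.2 fun t ht ↦ (hx t ht).1)
      (image_subset_iff.2 fun t ht ↦ (hy t ht).1))
    ((isCompact_Icc.image_of_continuousOn hx.continuousOn).union
      (isCompact_Icc.image_of_continuousOn hy.continuousOn))
  intro t ht
  have := IsSolOn.norm_sub_le hL hlip
    (fun s hs ↦ ⟨Or.inl (mem_image_of_mem x hs), (hx s hs).2⟩)
    (fun s hs ↦ ⟨Or.inr (mem_image_of_mem y hs), (hy s hs).2⟩) t ht
  rw [h, sub_self, norm_zero, zero_mul] at this
  exact sub_eq_zero.1 (norm_le_zero_iff.1 this)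

/-- A function with nonpositive orbital derivative does not increase along solutions. -/
lemma IsSolOn.antitoneOn_lyapunov (hDopen : IsOpen D) {V : EuclideanSpace ℝ (Fin n) → ℝ}
    (hV : ContDiffOn ℝ 1 V D) (hVf : ∀ t : ℝ, ∀ x ∈ D, fderiv ℝ V x (f t x) ≤ 0)
    {a b : ℝ} (hx : IsSolOn D f x (Icc a b)) : AntitoneOn (fun t ↦ V (x t)) (Icc a b) := by
  have hder : ∀ t ∈ Icc a b,
      HasDerivAt (fun t ↦ V (x t)) (fderiv ℝ V (x t) (f t (x t))) t := fun t ht ↦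
    (((hV.differentiableOn one_ne_zero).differentiableAt
      (hDopen.mem_nhds (hx t ht).1)).hasFDerivAt).comp_hasDerivAt t (hx t ht).2
  refine antitoneOn_of_hasDerivWithinAt_nonpos (convex_Icc a b)
    (fun t ht ↦ (hder t ht).continuousAt.continuousWithinAt)
    (fun t ht ↦ (hder t (interior_subset ht)).hasDerivWithinAt)
    (fun t ht ↦ hVf t _ (hx t (interior_subset ht)).1)

/-- The zero set of a nonnegative Lyapunov function lies in the maximal positively invariant
subset of the zero set of its decay bound. -/
lemma zeroSet_subset_maxPosInv (hDopen : IsOpen D) {V W : EuclideanSpace ℝ (Fin n) → ℝ}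
    (hV : ContDiffOn ℝ 1 V D) (hVnonneg : ∀ x ∈ D, 0 ≤ V x)
    (hVW : ∀ t : ℝ, ∀ x ∈ D, fderiv ℝ V x (f t x) ≤ W x) (hWnonpos : ∀ x ∈ D, W x ≤ 0) :
    {z ∈ D | V z = 0} ⊆ MaxPosInv D f {z ∈ D | W z = 0} := by
  refine subset_sUnion_of_mem ⟨?_, ?_⟩
  · rintro z ⟨hz, hVz⟩
    refine ⟨hz, le_antisymm (hWnonpos z hz) ?_⟩
    have hmin : IsLocalMin V z := by
      filter_upwards [hDopen.mem_nhds hz] with w hw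
      rw [hVz]
      exact hVnonneg w hw
    simpa [hmin.fderiv_eq_zero] using hVW 0 z hz
  · rintro t₀ t₁ x hx ⟨-, hx₀⟩ t ht
    have hle := hx.antitoneOn_lyapunov hDopen hV
      (fun s z hz ↦ (hVW s z hz).trans (hWnonpos z hz)) (left_mem_Icc.2 (ht.1.trans ht.2)) ht ht.1
    simp only [hx₀] at hle
    exact ⟨(hx t ht).1, le_antisymm hle (hVnonneg _ (hx t ht).1)⟩

/-- If `ε` cannot be attained as a norm by a solution that stayed in the closed `ε`-ball, then
solutions starting at a point of the open ball exist for all time and stay in it. -/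
lemma exists_solution_of_no_exit {ε L C : ℝ} (hε : 0 < ε) (hL : 0 < L)
    (hball : closedBall 0 ε ⊆ D)
    (hlip : ∀ t : ℝ, ∀ x ∈ closedBall 0 ε, ∀ y ∈ closedBall 0 ε,
      ‖f t x - f t y‖ ≤ L * ‖x - y‖)
    (hbdd : ∀ t : ℝ, ∀ x ∈ closedBall 0 ε, ‖f t x‖ ≤ C)
    (hcont : ∀ x ∈ D, Continuous fun t ↦ f t x)
    {t₀ : ℝ} {x₀ : EuclideanSpace ℝ (Fin n)} (hx₀ : ‖x₀‖ < ε)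
    (hexit : ∀ (x : ℝ → EuclideanSpace ℝ (Fin n)) (t₁ : ℝ), t₀ ≤ t₁ → x t₀ = x₀ →
      IsSolOn (closedBall 0 ε) f x (Icc t₀ t₁) → ‖x t₁‖ ≠ ε) :
    ∃ x : ℝ → EuclideanSpace ℝ (Fin n), x t₀ = x₀ ∧ IsSolOn D f x (Ici t₀) ∧
      ∀ t > t₀, ‖x t‖ < ε := by
  obtain ⟨P, hP, hPmem, hPeq⟩ := exists_lipschitz_retraction
    (K := closedBall (0 : EuclideanSpace ℝ (Fin n)) ε) (nonempty_closedBall.2 hε.le)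
    isClosed_closedBall.isComplete (convex_closedBall 0 ε)
  have hC : 0 ≤ C := (norm_nonneg _).trans (hbdd 0 0 (mem_closedBall_self hε.le))
  obtain ⟨x, hxt₀, hx⟩ := exists_global_solution (g := fun t z ↦ f t (P z)) (K := ⟨L, hL.le⟩)
    (C := ⟨C, hC⟩)
    (fun t ↦ LipschitzWith.of_dist_le_mul fun u v ↦ by
      have h := hlip t _ (hPmem u) _ (hPmem v)
      have h' := hP.dist_le_mul u v
      simp only [dist_eq_norm, NNReal.coe_one, one_mul] at h' ⊢
      exact h.trans (mul_le_mul_of_nonneg_left h' hL.le))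
    (fun z ↦ hcont _ (hball (hPmem z))) (fun t z ↦ hbdd t _ (hPmem z)) t₀ x₀
  have hxc : Continuous x := continuous_iff_continuousAt.2 fun t ↦ (hx t).continuousAt
  have hsol : ∀ s : Set ℝ, (∀ t ∈ s, ‖x t‖ ≤ ε) → IsSolOn (closedBall 0 ε) f x s := by
    intro s hs t ht
    have hmem : x t ∈ closedBall (0 : EuclideanSpace ℝ (Fin n)) ε := by simpa using hs t ht
    refine ⟨hmem, ?_⟩
    simpa [hPeq _ hmem] using hx t
  have hstay : ∀ t ≥ t₀, ‖x t‖ < ε := by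
    by_contra! hne
    obtain ⟨t, ht, htε⟩ := hne
    have hmem : ε ∈ (fun s ↦ ‖x s‖) '' Icc t₀ t :=
      intermediate_value_Icc ht hxc.norm.continuousOn ⟨by simpa [hxt₀] using hx₀.le, htε⟩
    have hcomp : IsCompact (Icc t₀ t ∩ (fun s ↦ ‖x s‖) ⁻¹' {ε}) :=
      isCompact_Icc.inter_right (isClosed_singleton.preimage hxc.norm)
    obtain ⟨t₁, ⟨ht₁, ht₁ε⟩, hleast⟩ := hcomp.exists_isLeast
      (by obtain ⟨s, hs, hsε⟩ := hmem; exact ⟨s, hs, hsε⟩)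
    refine hexit x t₁ ht₁.1 hxt₀ (hsol _ fun s hs ↦ ?_) ht₁ε
    by_contra! hgt
    obtain ⟨r, hr, hrε⟩ : ε ∈ (fun s ↦ ‖x s‖) '' Icc t₀ s :=
      intermediate_value_Icc hs.1 hxc.norm.continuousOn ⟨by simpa [hxt₀] using hx₀.le, hgt.le⟩
    have hle : t₁ ≤ r := hleast ⟨⟨hr.1, hr.2.trans (hs.2.trans ht₁.2)⟩, hrε⟩
    have hst : s = t₁ := le_antisymm hs.2 (hle.trans hr.2)
    rw [hst] at hgt
    exact hgt.ne' ht₁ε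
  exact ⟨x, hxt₀, (hsol _ fun t ht ↦ (hstay t ht).le).mono hball Subset.rfl,
    fun t ht ↦ hstay t ht.le⟩

/-- Asymptotic stability is uniform on compact sets of initial conditions whose trajectories
converge to the origin. -/
lemma StableOn.exists_uniform_time {ε ε₀ L : ℝ} (hL : 0 < L)
    (hlip : ∀ t : ℝ, ∀ x ∈ closedBall 0 ε₀, ∀ y ∈ closedBall 0 ε₀,
      ‖f t x - f t y‖ ≤ L * ‖x - y‖)
    (hf_lip : ∀ K : Set (EuclideanSpace ℝ (Fin n)), K ⊆ D → IsCompact K →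
      ∃ L > (0 : ℝ), ∀ t : ℝ, ∀ x ∈ K, ∀ y ∈ K, ‖f t x - f t y‖ ≤ L * ‖x - y‖)
    (hND : N ⊆ D) (hinv : ∀ t t₀ : ℝ, ∀ z ∈ N, f t z = f t₀ z) (hstab : StableOn N f)
    (hε : 0 < ε) {A : Set (EuclideanSpace ℝ (Fin n))} (hA : IsCompact A)
    (hflow : ∀ z ∈ A, ∃ φ : ℝ → EuclideanSpace ℝ (Fin n), φ 0 = z ∧ IsSolOn N f φ (Ici 0) ∧
      (∀ t ≥ 0, ‖φ t‖ ≤ ε₀) ∧ Tendsto φ atTop (𝓝 0)) :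
    ∃ T > 0, ∀ φ : ℝ → EuclideanSpace ℝ (Fin n), φ 0 ∈ A → IsSolOn N f φ (Ici 0) →
      (∀ t ≥ 0, ‖φ t‖ ≤ ε₀) → ‖φ T‖ < ε := by
  obtain ⟨δ, hδ, hδstab⟩ := hstab 0 ε hε
  suffices h : ∃ T, ∀ φ : ℝ → EuclideanSpace ℝ (Fin n), φ 0 ∈ A → IsSolOn N f φ (Ici 0) →
      (∀ t ≥ 0, ‖φ t‖ ≤ ε₀) → ∀ t > T, ‖φ t‖ < ε by
    obtain ⟨T, hT⟩ := h
    exact ⟨max T 0 + 1, by positivity, fun φ h₀ hφ hb ↦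
      hT φ h₀ hφ hb _ (by linarith [le_max_left T 0])⟩
  refine hA.induction_on (p := fun s ↦ ∃ T, ∀ φ : ℝ → EuclideanSpace ℝ (Fin n), φ 0 ∈ s →
    IsSolOn N f φ (Ici 0) → (∀ t ≥ 0, ‖φ t‖ ≤ ε₀) → ∀ t > T, ‖φ t‖ < ε) ?_ ?_ ?_ ?_
  · exact ⟨0, fun φ h ↦ absurd h (notMem_empty _)⟩
  · rintro s s' hss' ⟨T, hT⟩
    exact ⟨T, fun φ h ↦ hT φ (hss' h)⟩
  · rintro s s' ⟨T, hT⟩ ⟨T', hT'⟩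
    refine ⟨max T T', fun φ h hφ hb t ht ↦ ?_⟩
    rcases h with h | h
    · exact hT φ h hφ hb t ((le_max_left _ _).trans_lt ht)
    · exact hT' φ h hφ hb t ((le_max_right _ _).trans_lt ht)
  · intro z hz
    obtain ⟨φ, hφz, hφ, hφb, hφlim⟩ := hflow z hz
    have hev : ∀ᶠ t in atTop, ‖φ t‖ < δ :=
      hφlim.norm.eventually_lt_const (by simpa using hδ)
    obtain ⟨T, hTδ, hT⟩ := (hev.and (eventually_ge_atTop 0)).exists
    have hnhds : ∀ᶠ w in 𝓝 z, ‖w - z‖ * Real.exp (L * T) < δ - ‖φ T‖ :=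
      (by fun_prop : Continuous fun w ↦ ‖w - z‖ * Real.exp (L * T)).continuousAt.eventually_lt_const
        (by simpa using hTδ)
    refine ⟨_, mem_nhdsWithin_of_mem_nhds hnhds, T, fun ψ hψ₀ hψ hψb t ht ↦ ?_⟩
    have hclose := IsSolOn.norm_sub_le (x := ψ) (y := φ) (a := 0) (b := T) hL hlip
      (fun s hs ↦ ⟨by simpa using hψb s hs.1, (hψ s hs.1).2⟩)
      (fun s hs ↦ ⟨by simpa using hφb s hs.1, (hφ s hs.1).2⟩) T (right_mem_Icc.2 hT)
    rw [hφz, sub_zero] at hclose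
    have hψT : ‖ψ T‖ < δ := by
      have := norm_le_norm_add_norm_sub' (ψ T) (φ T)
      have hlt : ‖ψ 0 - z‖ * Real.exp (L * T) < δ - ‖φ T‖ := hψ₀
      linarith
    obtain ⟨χ, hχ₀, hχ, hχε⟩ := hδstab (ψ T) (hψ T hT).1 hψT
    have heq := IsSolOn.eq_of_eq hf_lip (a := 0) (b := t - T)
      ((hψ.shift hinv hT).mono hND Icc_subset_Ici_self)
      (hχ.mono hND Icc_subset_Ici_self) (by simp [hχ₀]) (t - T) ⟨by linarith, le_rfl⟩
    rw [sub_add_cancel] at heq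
    rw [heq]
    exact hχε _ (by linarith)

/-- If trajectories from the zero set of `V` are inside the open `ε`-ball at time `T`, so are
solutions starting at a low level of `V`. -/
lemma exists_level_norm_lt {ε ε₀ L T : ℝ} (hL : 0 < L) (hT : 0 ≤ T) (hεε₀ : ε ≤ ε₀)
    (hlip : ∀ t : ℝ, ∀ x ∈ closedBall 0 ε₀, ∀ y ∈ closedBall 0 ε₀,
      ‖f t x - f t y‖ ≤ L * ‖x - y‖)
    (hinv : ∀ t t₀ : ℝ, ∀ z ∈ N, f t z = f t₀ z)
    {V : EuclideanSpace ℝ (Fin n) → ℝ} (hV : ContinuousOn V (closedBall 0 ε))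
    (hVnonneg : ∀ z ∈ closedBall 0 ε, 0 ≤ V z)
    (hflow : ∀ z ∈ closedBall 0 ε, V z = 0 → ∃ φ : ℝ → EuclideanSpace ℝ (Fin n), φ 0 = z ∧
      IsSolOn N f φ (Ici 0) ∧ (∀ t ≥ 0, ‖φ t‖ ≤ ε₀) ∧ ‖φ T‖ < ε) :
    ∃ ν > 0, ∀ (t₀ : ℝ) (x : ℝ → EuclideanSpace ℝ (Fin n)),
      IsSolOn (closedBall 0 ε) f x (Icc t₀ (t₀ + T)) → V (x t₀) < ν → ‖x (t₀ + T)‖ < ε := by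
  suffices h : ∃ ν > 0, ∀ (t₀ : ℝ) (x : ℝ → EuclideanSpace ℝ (Fin n)),
      x t₀ ∈ closedBall (0 : EuclideanSpace ℝ (Fin n)) ε →
      IsSolOn (closedBall 0 ε) f x (Icc t₀ (t₀ + T)) → V (x t₀) < ν → ‖x (t₀ + T)‖ < ε by
    obtain ⟨ν, hν, h⟩ := h
    exact ⟨ν, hν, fun t₀ x hx ↦ h t₀ x (hx t₀ (left_mem_Icc.2 (by linarith))).1 hx⟩
  refine (isCompact_closedBall _ _).induction_on (p := fun s ↦ ∃ ν > 0, ∀ (t₀ : ℝ)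
    (x : ℝ → EuclideanSpace ℝ (Fin n)), x t₀ ∈ s →
    IsSolOn (closedBall 0 ε) f x (Icc t₀ (t₀ + T)) → V (x t₀) < ν → ‖x (t₀ + T)‖ < ε)
    ?_ ?_ ?_ ?_
  · exact ⟨1, one_pos, fun t₀ x h ↦ absurd h (notMem_empty _)⟩
  · rintro s s' hss' ⟨ν, hν, h⟩
    exact ⟨ν, hν, fun t₀ x hx ↦ h t₀ x (hss' hx)⟩
  · rintro s s' ⟨ν, hν, h⟩ ⟨ν', hν', h'⟩
    refine ⟨min ν ν', lt_min hν hν', fun t₀ x hx hsol hlt ↦ ?_⟩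
    rcases hx with hx | hx
    · exact h t₀ x hx hsol (hlt.trans_le (min_le_left _ _))
    · exact h' t₀ x hx hsol (hlt.trans_le (min_le_right _ _))
  · intro z hz
    rcases (hVnonneg z hz).eq_or_lt' with hVz | hVz
    · obtain ⟨φ, hφz, hφ, hφb, hφT⟩ := hflow z hz hVz
      have hnhds : ∀ᶠ w in 𝓝 z, ‖w - z‖ * Real.exp (L * T) < ε - ‖φ T‖ :=
        (by fun_prop :
          Continuous fun w ↦ ‖w - z‖ * Real.exp (L * T)).continuousAt.eventually_lt_const
          (by simpa using hφT)
      refine ⟨_, mem_nhdsWithin_of_mem_nhds hnhds, 1, one_pos, fun t₀ x hx₀ hx _ ↦ ?_⟩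
      have hclose := IsSolOn.norm_sub_le (x := x) (y := fun t ↦ φ (t - t₀)) (a := t₀)
        (b := t₀ + T) hL hlip (hx.mono (closedBall_subset_closedBall hεε₀) Subset.rfl)
        (fun s hs ↦ ⟨by simpa using hφb (s - t₀) (sub_nonneg.2 hs.1),
          ((hφ.translate hinv t₀) s hs.1).2⟩) (t₀ + T) (right_mem_Icc.2 (by linarith))
      simp only [sub_self, hφz, add_sub_cancel_left] at hclose
      have hlt : ‖x t₀ - z‖ * Real.exp (L * T) < ε - ‖φ T‖ := hx₀
      have := norm_le_norm_add_norm_sub' (x (t₀ + T)) (φ T)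
      linarith
    · have hnhds : ∀ᶠ w in 𝓝[closedBall 0 ε] z, V z / 2 < V w :=
        (hV z hz).eventually_const_lt (half_lt_self hVz)
      exact ⟨_, hnhds, V z / 2, half_pos hVz, fun t₀ x hx₀ _ hlt ↦
        absurd hlt (not_lt.2 (le_of_lt hx₀))⟩

/-- Trajectories of an asymptotically stable restriction that start near the origin both stay
near the origin and converge to it. -/
lemma AsympStableOn.exists_flow
    (hf_lip : ∀ K : Set (EuclideanSpace ℝ (Fin n)), K ⊆ D → IsCompact K →
      ∃ L > (0 : ℝ), ∀ t : ℝ, ∀ x ∈ K, ∀ y ∈ K, ‖f t x - f t y‖ ≤ L * ‖x - y‖)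
    (hND : N ⊆ D) (h : AsympStableOn N f) {ε : ℝ} (hε : 0 < ε) :
    ∃ δ > 0, ∀ z ∈ N, ‖z‖ < δ → ∃ φ : ℝ → EuclideanSpace ℝ (Fin n), φ 0 = z ∧
      IsSolOn N f φ (Ici 0) ∧ (∀ t ≥ 0, ‖φ t‖ ≤ ε) ∧ Tendsto φ atTop (𝓝 0) := by
  obtain ⟨δ₁, hδ₁, hstab⟩ := h.1 0 ε hε
  obtain ⟨δ₂, hδ₂, hattr⟩ := h.2 0
  refine ⟨min ε (min δ₁ δ₂), by positivity, fun z hz hzδ ↦ ?_⟩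
  obtain ⟨hzε, hz₁, hz₂⟩ := by simpa only [lt_min_iff] using hzδ
  obtain ⟨φ, hφ₀, hφ, hφε⟩ := hstab z hz hz₁
  obtain ⟨ψ, hψ₀, hψ, hψlim⟩ := hattr z hz hz₂
  refine ⟨φ, hφ₀, hφ, fun t ht ↦ ?_, hψlim.congr' ?_⟩
  · rcases eq_or_lt_of_le ht with rfl | ht
    · rw [hφ₀]
      exact hzε.le
    · exact (hφε t ht).le
  · filter_upwards [eventually_ge_atTop 0] with t ht
    exact IsSolOn.eq_of_eq hf_lip (hψ.mono hND Icc_subset_Ici_self)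
      (hφ.mono hND Icc_subset_Ici_self) (hψ₀.trans hφ₀.symm) t (right_mem_Icc.2 ht)

end

/-- under the hypotheses of the main theorem, asymptotic stability of the
origin for the dynamics restricted to the maximal positively invariant set `N ⊆ E`
implies uniform stability of the origin for `ẋ = f t x`; in particular solutions starting
sufficiently close to the origin are defined for all positive time. -/
theorem uniformlyStable_of_asympStable_restricted
    {n : ℕ} (D : Set (EuclideanSpace ℝ (Fin n))) (hDopen : IsOpen D)
    (hDconn : IsConnected D) (h0D : (0 : EuclideanSpace ℝ (Fin n)) ∈ D)
    (f : ℝ → EuclideanSpace ℝ (Fin n) → EuclideanSpace ℝ (Fin n))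
    (hf0 : ∀ t : ℝ, f t 0 = 0)
    (hf_unif_t : ∀ ε > (0 : ℝ), ∃ δ > (0 : ℝ), ∀ t₁ t₂ : ℝ, |t₁ - t₂| < δ →
      ∀ x ∈ D, ‖f t₁ x - f t₂ x‖ < ε)
    (hf_lip : ∀ K : Set (EuclideanSpace ℝ (Fin n)), K ⊆ D → IsCompact K →
      ∃ L > (0 : ℝ), ∀ t : ℝ, ∀ x ∈ K, ∀ y ∈ K, ‖f t x - f t y‖ ≤ L * ‖x - y‖)
    (M : EuclideanSpace ℝ (Fin n) → ℝ) (hM : ContinuousOn M D)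
    (hf_bdd : ∀ t : ℝ, ∀ x ∈ D, ‖f t x‖ ≤ M x)
    (V : EuclideanSpace ℝ (Fin n) → ℝ) (hV : ContDiffOn ℝ 1 V D)
    (hVnonneg : ∀ x ∈ D, 0 ≤ V x) (hV0 : V 0 = 0)
    (W : EuclideanSpace ℝ (Fin n) → ℝ) (hW : ContinuousOn W D)
    (hVW : ∀ t : ℝ, ∀ x ∈ D, fderiv ℝ V x (f t x) ≤ W x)
    (hWnonpos : ∀ x ∈ D, W x ≤ 0)
    (htinv : ∀ t t₀ : ℝ, ∀ x ∈ {y ∈ D | W y = 0}, f t x = f t₀ x)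
    (hrestr : AsympStableOn (MaxPosInv D f {y ∈ D | W y = 0}) f) :
    UniformlyStable D f := by
  have hVf : ∀ t : ℝ, ∀ x ∈ D, fderiv ℝ V x (f t x) ≤ 0 := fun t x hx ↦
    (hVW t x hx).trans (hWnonpos x hx)
  have hNE : MaxPosInv D f {y ∈ D | W y = 0} ⊆ {y ∈ D | W y = 0} := sUnion_subset fun _ h ↦ h.1
  have hZN := zeroSet_subset_maxPosInv hDopen hV hVnonneg hVW hWnonpos
  set N := MaxPosInv D f {y ∈ D | W y = 0}
  have hND : N ⊆ D := fun z hz ↦ (hNE hz).1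
  have hinv : ∀ t t₀ : ℝ, ∀ z ∈ N, f t z = f t₀ z := fun t t₀ z hz ↦ htinv t t₀ z (hNE hz)
  have hcont : ∀ x ∈ D, Continuous fun t ↦ f t x := fun x hx ↦ Metric.continuous_iff.2
    fun t ε hε ↦ by
      obtain ⟨δ, hδ, h⟩ := hf_unif_t ε hε
      exact ⟨δ, hδ, fun s hs ↦ by
        rw [dist_eq_norm]
        exact h s t (by rwa [Real.dist_eq] at hs) x hx⟩
  obtain ⟨ε₀, hε₀, hε₀D⟩ := Metric.nhds_basis_closedBall.mem_iff.1 (hDopen.mem_nhds h0D)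
  obtain ⟨L, hL, hlip⟩ := hf_lip _ hε₀D (isCompact_closedBall _ _)
  obtain ⟨C, hC⟩ := (isCompact_closedBall _ _).bddAbove_image (hM.mono hε₀D)
  obtain ⟨ε₁, hε₁, hflow⟩ := hrestr.exists_flow hf_lip hND hε₀
  intro ε' hε'
  obtain ⟨ε, hε, hεε', hεε₀, hεε₁⟩ : ∃ ε > 0, ε ≤ ε' ∧ ε ≤ ε₀ ∧ ε < ε₁ :=
    ⟨min ε' (min ε₀ (ε₁ / 2)), by positivity, min_le_left _ _,
      (min_le_right _ _).trans (min_le_left _ _),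
      ((min_le_right _ _).trans (min_le_right _ _)).trans_lt (half_lt_self hε₁)⟩
  have hball : closedBall (0 : EuclideanSpace ℝ (Fin n)) ε ⊆ closedBall 0 ε₀ :=
    closedBall_subset_closedBall hεε₀
  have hεD := hball.trans hε₀D
  have hVball : ContinuousOn V (closedBall 0 ε) := hV.continuousOn.mono hεD
  have hA : IsCompact (closedBall 0 ε ∩ V ⁻¹' {0}) :=
    (isCompact_closedBall _ _).of_isClosed_subset
      (hVball.preimage_isClosed_of_isClosed isClosed_closedBall isClosed_singleton)
      inter_subset_left
  have hflowA : ∀ z ∈ closedBall 0 ε ∩ V ⁻¹' {0}, ∃ φ : ℝ → EuclideanSpace ℝ (Fin n), φ 0 = z ∧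
      IsSolOn N f φ (Ici 0) ∧ (∀ t ≥ 0, ‖φ t‖ ≤ ε₀) ∧ Tendsto φ atTop (𝓝 0) := fun z hz ↦
    hflow z (hZN ⟨hεD hz.1, hz.2⟩) ((mem_closedBall_zero_iff.1 hz.1).trans_lt hεε₁)
  obtain ⟨T, hT, hTε⟩ := hrestr.1.exists_uniform_time hL hlip hf_lip hND hinv hε hA hflowA
  obtain ⟨ν, hν, hlevel⟩ := exists_level_norm_lt hL hT.le hεε₀ hlip hinv hVball
    (fun z hz ↦ hVnonneg z (hεD hz)) fun z hz hVz ↦ by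
      obtain ⟨φ, hφz, hφ, hφb, -⟩ := hflowA z ⟨hz, hVz⟩
      exact ⟨φ, hφz, hφ, hφb, hTε φ (hφz ▸ ⟨hz, hVz⟩) hφ hφb⟩
  have hVnear : ∀ᶠ z in 𝓝 0, V z < ν :=
    (hV.continuousOn.continuousAt (hDopen.mem_nhds h0D)).eventually_lt_const (by rwa [hV0])
  obtain ⟨δ, hδ, hδV⟩ := Metric.eventually_nhds_iff.1 hVnear
  have hexp := Real.exp_pos (L * T)
  refine ⟨min δ (ε / Real.exp (L * T)), by positivity, fun t₀ x₀ _ hx₀ ↦ ?_⟩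
  obtain ⟨hx₀δ, hx₀T⟩ := lt_min_iff.1 hx₀
  rw [lt_div_iff₀ hexp] at hx₀T
  have hx₀ε : ‖x₀‖ < ε := by
    nlinarith [norm_nonneg x₀, Real.one_le_exp (mul_pos hL hT).le]
  obtain ⟨x, hxt₀, hx, hxε⟩ := exists_solution_of_no_exit hε hL hεD
    (fun t y hy z hz ↦ hlip t y (hball hy) z (hball hz))
    (fun t z hz ↦ (hf_bdd t z (hεD hz)).trans (hC (mem_image_of_mem M (hball hz)))) hcont hx₀ε
    (t₀ := t₀) fun x t₁ ht₁ hxt₀ hx hxt₁ ↦ by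
      rcases le_total t₁ (t₀ + T) with hle | hle
      · have hgrow := IsSolOn.norm_sub_le (y := fun _ ↦ 0) hL hlip (hx.mono hball Subset.rfl)
          (fun t _ ↦ ⟨mem_closedBall_self hε₀.le, by simpa [hf0] using hasDerivAt_const t 0⟩)
          t₁ (right_mem_Icc.2 ht₁)
        simp only [sub_zero, hxt₀] at hgrow
        have hmono : Real.exp (L * (t₁ - t₀)) ≤ Real.exp (L * T) :=
          Real.exp_le_exp.2 (mul_le_mul_of_nonneg_left (by linarith) hL.le)
        have := mul_le_mul_of_nonneg_left hmono (norm_nonneg x₀)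
        linarith
      · have hmem : t₁ - T ∈ Icc t₀ t₁ := ⟨by linarith, by linarith⟩
        have hVle : V (x (t₁ - T)) ≤ V (x t₀) :=
          (hx.mono hεD Subset.rfl).antitoneOn_lyapunov hDopen hV hVf (left_mem_Icc.2 ht₁) hmem
            hmem.1
        have hlt := hlevel (t₁ - T) x
          (hx.mono Subset.rfl (Icc_subset_Icc hmem.1 (by linarith)))
          (hVle.trans_lt (hxt₀ ▸ hδV (by simpa using hx₀δ)))
        rw [sub_add_cancel] at hlt
        exact hlt.ne hxt₁
  exact ⟨x, hxt₀, hx, fun t ht ↦ (hxε t ht).trans_le hεε'⟩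
end

section
/- Consider the inputless nonlinear control system ẋ = f(x), y = h(x), with f : D → ℝⁿ locally Lipschitz and h : D → ℝᵖ continuous on a domain D ⊆ ℝⁿ containing the origin, f(0) = 0 and h(0) = 0. Let E = {x ∈ D : h(x) = 0} and let N be the maximal positively invariant set of ẋ = f(x) contained in E. Suppose there exist q > 0 and a C¹ function V : D → ℝ with V ≥ 0 on D and V(0) = 0 satisfying the nonlinear Liapunov inequality ∇V(x)·f(x) + ‖h(x)‖^q ≤ 0 for all x ∈ D (in particular any solution of the equation ∇V·f + ‖h‖^q = 0 qualifies). Then the pair (h,f) is strongly zero-state detectable if and only if the origin is an asymptotically stable equilibrium of ẋ = f(x). -/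
open Set Filter Metric Topology

/-- `f` is locally Lipschitz on the set `D`. -/
def LocLipOn {n : ℕ} {F : Type*} [NormedAddCommGroup F]
    (D : Set (EuclideanSpace ℝ (Fin n))) (f : EuclideanSpace ℝ (Fin n) → F) : Prop :=
  ∀ x ∈ D, ∃ ε > (0 : ℝ), ∃ L : ℝ, 0 ≤ L ∧
    ∀ y ∈ D ∩ ball x ε, ∀ z ∈ D ∩ ball x ε, ‖f y - f z‖ ≤ L * ‖y - z‖

/-- `x` solves the autonomous ODE `ẋ = f x`, staying in the set `D`, on the time set `s`. -/
def IsSolOnAut {n : ℕ} (D : Set (EuclideanSpace ℝ (Fin n)))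
    (f : EuclideanSpace ℝ (Fin n) → EuclideanSpace ℝ (Fin n))
    (x : ℝ → EuclideanSpace ℝ (Fin n)) (s : Set ℝ) : Prop :=
  ∀ t ∈ s, x t ∈ D ∧ HasDerivAt x (f (x t)) t

/-- `S` is positively invariant for the autonomous dynamics `ẋ = f x` on `D`. -/
def PosInvariantAut {n : ℕ} (D : Set (EuclideanSpace ℝ (Fin n)))
    (f : EuclideanSpace ℝ (Fin n) → EuclideanSpace ℝ (Fin n))
    (S : Set (EuclideanSpace ℝ (Fin n))) : Prop :=
  ∀ (t₀ t₁ : ℝ) (x : ℝ → EuclideanSpace ℝ (Fin n)),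
    IsSolOnAut D f x (Icc t₀ t₁) → x t₀ ∈ S → ∀ t ∈ Icc t₀ t₁, x t ∈ S

/-- The maximal positively invariant subset of `E` for the dynamics `ẋ = f x` on `D`. -/
def MaxPosInvAut {n : ℕ} (D : Set (EuclideanSpace ℝ (Fin n)))
    (f : EuclideanSpace ℝ (Fin n) → EuclideanSpace ℝ (Fin n))
    (E : Set (EuclideanSpace ℝ (Fin n))) : Set (EuclideanSpace ℝ (Fin n)) :=
  ⋃₀ {S | S ⊆ E ∧ PosInvariantAut D f S}

/-- The origin is an asymptotically stable equilibrium (stable and attractive) of the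
autonomous dynamics `ẋ = f x` restricted to the set `S`. -/
def AsympStableAut {n : ℕ} (S : Set (EuclideanSpace ℝ (Fin n)))
    (f : EuclideanSpace ℝ (Fin n) → EuclideanSpace ℝ (Fin n)) : Prop :=
  (∀ ε > (0 : ℝ), ∃ δ > (0 : ℝ), ∀ x₀ ∈ S, ‖x₀‖ < δ →
    ∃ x : ℝ → EuclideanSpace ℝ (Fin n), x 0 = x₀ ∧ IsSolOnAut S f x (Ici 0) ∧
      ∀ t ≥ (0 : ℝ), ‖x t‖ < ε) ∧
  (∃ δ > (0 : ℝ), ∀ x₀ ∈ S, ‖x₀‖ < δ →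
    ∃ x : ℝ → EuclideanSpace ℝ (Fin n), x 0 = x₀ ∧ IsSolOnAut S f x (Ici 0) ∧
      Tendsto x atTop (𝓝 0))

/-- The pair `(h, f)` is strongly zero-state detectable: the origin is an asymptotically
stable equilibrium of the dynamics restricted to the maximal positively invariant set `N`
contained in `E = ker h`. -/
def StrongZSD {n p : ℕ} (D : Set (EuclideanSpace ℝ (Fin n)))
    (f : EuclideanSpace ℝ (Fin n) → EuclideanSpace ℝ (Fin n))
    (h : EuclideanSpace ℝ (Fin n) → EuclideanSpace ℝ (Fin p)) : Prop :=
  AsympStableAut (MaxPosInvAut D f {x ∈ D | h x = 0}) f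

section Flow

variable {E : Type*} [NormedAddCommGroup E] [NormedSpace ℝ E]

/-- A bounded Lipschitz vector field on a Banach space has a global integral curve through every
point. -/
theorem exists_global_hasDerivAt_of_lipschitz_of_bounded [CompleteSpace E] {g : E → E} {K : NNReal}
    {C : ℝ} (hg : LipschitzWith K g) (hC : ∀ x, ‖g x‖ ≤ C) (x₀ : E) :
    ∃ x : ℝ → E, x 0 = x₀ ∧ ∀ t, HasDerivAt x (g (x t)) t := by
  have hC0 : 0 ≤ C := (norm_nonneg _).trans (hC 0)
  have hloc : ∀ T : ℝ, 0 < T → ∃ α : ℝ → E, α 0 = x₀ ∧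
      ∀ t ∈ Ioo (-T) T, HasDerivAt α (g (α t)) t := by
    intro T hT
    have hPL : IsPicardLindelof (fun _ : ℝ ↦ g) (tmin := -T) (tmax := T)
        ⟨0, by constructor <;> linarith⟩ x₀ (C.toNNReal * T.toNNReal) 0 C.toNNReal K :=
      { lipschitzOnWith := fun _ _ ↦ hg.lipschitzOnWith
        continuousOn := fun _ _ ↦ continuousOn_const
        norm_le := fun _ _ x _ ↦ by simpa [hC0] using hC x
        mul_max_le := by simp [hC0, hT.le] }
    obtain ⟨α, hα0, hα⟩ := hPL.exists_eq_forall_mem_Icc_hasDerivWithinAt₀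
    exact ⟨α, hα0, fun t ht ↦ (hα t (Ioo_subset_Icc_self ht)).hasDerivAt
      (Icc_mem_nhds ht.1 ht.2)⟩
  choose! α hα0 hα using hloc
  have huniq : ∀ S T : ℝ, 0 < S → S ≤ T → EqOn (α S) (α T) (Ioo (-S) S) := by
    intro S T hS hST
    refine ODE_solution_unique_of_mem_Ioo (v := fun _ ↦ g) (s := fun _ ↦ univ) (t₀ := 0)
      (fun _ _ ↦ hg.lipschitzOnWith) ⟨by linarith, hS⟩
      (fun t ht ↦ ⟨hα S hS t ht, trivial⟩)
      (fun t ht ↦ ⟨hα T (by linarith) t ⟨by linarith [ht.1], by linarith [ht.2]⟩, trivial⟩) ?_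
    rw [hα0 S hS, hα0 T (by linarith)]
  refine ⟨fun t ↦ α (|t| + 1) t, hα0 _ (by positivity), fun t ↦ ?_⟩
  have heq : ∀ s : ℝ, |s| < |t| + 1 → α (|s| + 1) s = α (|t| + 2) s := fun s hs ↦
    huniq _ _ (by positivity) (by linarith) (abs_lt.1 (by linarith))
  have hev : (fun s ↦ α (|s| + 1) s) =ᶠ[𝓝 t] α (|t| + 2) := by
    filter_upwards [continuous_abs.continuousAt.eventually_lt
      (continuousAt_const (y := |t| + 1)) (by linarith)] with s hs using heq s hs
  have := hα (|t| + 2) (by positivity) t (abs_lt.1 (by linarith))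
  rw [← heq t (by linarith)] at this
  exact this.congr_of_eventuallyEq hev

/-- A bounded Lipschitz vector field on a Banach space generates a global flow, whose time-`t` map
is Lipschitz with constant `exp (K * t)`. -/
theorem exists_flow_of_lipschitz_of_bounded [CompleteSpace E] {g : E → E} {K : NNReal}
    {C : ℝ} (hg : LipschitzWith K g) (hC : ∀ x, ‖g x‖ ≤ C) :
    ∃ φ : E → ℝ → E, (∀ x, φ x 0 = x) ∧ (∀ x t, HasDerivAt (φ x) (g (φ x t)) t) ∧
      (∀ x s t, φ (φ x s) t = φ x (s + t)) ∧
      ∀ x y t, 0 ≤ t → dist (φ x t) (φ y t) ≤ dist x y * Real.exp (K * t) := by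
  choose φ h0 hd using exists_global_hasDerivAt_of_lipschitz_of_bounded hg hC
  refine ⟨φ, h0, hd, fun x s t ↦ ?_, fun x y t ht ↦ ?_⟩
  · refine congrFun (ODE_solution_unique_univ (v := fun _ ↦ g) (s := fun _ ↦ univ) (t₀ := 0)
      (f := φ (φ x s)) (g := fun t ↦ φ x (s + t)) (fun _ ↦ hg.lipschitzOnWith)
      (fun t ↦ ⟨hd _ t, trivial⟩) (fun t ↦ ⟨?_, trivial⟩) ?_) t
    · exact (hd x (s + t)).comp_const_add s t
    · simp [h0]
  · have := dist_le_of_trajectories_ODE (v := fun _ ↦ g) (f := φ x) (g := φ y) (a := 0) (b := t)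
      (δ := dist x y) (fun _ ↦ hg) (HasDerivAt.continuousOn fun s _ ↦ hd x s)
      (fun s _ ↦ (hd x s).hasDerivWithinAt) (HasDerivAt.continuousOn fun s _ ↦ hd y s)
      (fun s _ ↦ (hd y s).hasDerivWithinAt) (by simp [h0]) t ⟨ht, le_rfl⟩
    simpa using this

end Flow

section Semidefinite

variable {E : Type*} [NormedAddCommGroup E] [ProperSpace E]
  {φ : E → ℝ → E} {V : E → ℝ} {N : Set E} {K r : ℝ}

/-- Stability from a semidefinite Liapunov function: if the zeros of `V` near the origin lie in a
set `N` relative to which the origin is stable and attractive, then the origin is stable. -/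
theorem stable_of_semidefinite (hφ : ∀ x, Continuous (φ x))
    (hadd : ∀ x s t, φ (φ x s) t = φ x (s + t))
    (hφx : ∀ t, 0 ≤ t → Continuous fun x ↦ φ x t)
    (hlip : ∀ x y t, 0 ≤ t → dist (φ x t) (φ y t) ≤ dist x y * Real.exp (K * t)) (hK : 0 ≤ K)
    (hfix : ∀ t, φ 0 t = 0) (hr : 0 < r) (hVc : ContinuousOn V (closedBall 0 r))
    (hVnonneg : ∀ x ∈ closedBall 0 r, 0 ≤ V x) (hV0 : V 0 = 0)
    (hmono : ∀ x t, 0 ≤ t → (∀ s ∈ Icc 0 t, φ x s ∈ closedBall 0 r) → V (φ x t) ≤ V x)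
    (hZ : ∀ z ∈ closedBall 0 r, V z = 0 → z ∈ N)
    (hN : ∃ δ > 0, ∀ z ∈ N, ‖z‖ < δ → ∀ t ≥ 0, φ z t ∈ N)
    (hstab : ∀ ε > 0, ∃ δ > 0, ∀ z ∈ N, ‖z‖ < δ → ∀ t ≥ 0, ‖φ z t‖ < ε)
    (hattr : ∃ δ > 0, ∀ z ∈ N, ‖z‖ < δ → Tendsto (φ z) atTop (𝓝 0)) :
    ∀ ε > 0, ∃ δ > 0, ∀ x, ‖x‖ < δ → ∀ t ≥ 0, ‖φ x t‖ < ε := by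
  obtain ⟨δN, hδN, hN⟩ := hN
  obtain ⟨δA, hδA, hattr⟩ := hattr
  intro ε₀ hε₀
  obtain ⟨ε, hε, hεε₀, hεr, hεN, hεA⟩ : ∃ ε > 0, ε ≤ ε₀ ∧ ε ≤ r ∧ ε < δN ∧ ε < δA := by
    refine ⟨min (min ε₀ r) (min (δN / 2) (δA / 2)), by positivity, ?_, ?_, ?_, ?_⟩
    · exact (min_le_left _ _).trans (min_le_left _ _)
    · exact (min_le_left _ _).trans (min_le_right _ _)
    · exact ((min_le_right _ _).trans (min_le_left _ _)).trans_lt (by linarith)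
    · exact ((min_le_right _ _).trans (min_le_right _ _)).trans_lt (by linarith)
  have hsub : closedBall (0 : E) ε ⊆ closedBall 0 r := closedBall_subset_closedBall hεr
  obtain ⟨δ, hδ, hstab⟩ := hstab ε hε
  -- a uniform time at which all zeros of `V` in the closed `ε`-ball are inside the open one
  have hunif : ∃ T > 0, ∀ z ∈ closedBall 0 ε ∩ V ⁻¹' {0}, ‖φ z T‖ < ε := by
    set Z := closedBall (0 : E) ε ∩ V ⁻¹' {0} with hZdef
    have hZN : ∀ z ∈ Z, z ∈ N ∧ ‖z‖ ≤ ε := fun z hz ↦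
      ⟨hZ z (hsub hz.1) hz.2, mem_closedBall_zero_iff.1 hz.1⟩
    have hZc : IsCompact Z := (isCompact_closedBall 0 ε).of_isClosed_subset
      ((hVc.mono hsub).preimage_isClosed_of_isClosed isClosed_closedBall isClosed_singleton)
      inter_subset_left
    have hpt : ∀ z ∈ Z, ∃ s ≥ 0, ‖φ z s‖ < δ := by
      intro z hz
      have ht := hattr z (hZN z hz).1 ((hZN z hz).2.trans_lt hεA)
      obtain ⟨s, hs, hs0⟩ := ((ht.norm.eventually_lt_const (by simpa using hδ)).and
        (eventually_ge_atTop 0)).exists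
      exact ⟨s, hs0, hs⟩
    choose! s hs0 hs using hpt
    obtain ⟨F, hFZ, hF⟩ := hZc.elim_nhds_subcover (fun z ↦ {w | ‖φ w (s z)‖ < δ})
      fun z hz ↦ ((hφx _ (hs0 z hz)).norm.isOpen_preimage _ isOpen_Iio).mem_nhds (hs z hz)
    refine ⟨∑ z ∈ F, s z + 1, add_pos_of_nonneg_of_pos
      (Finset.sum_nonneg fun z hz ↦ hs0 z (hFZ z hz)) one_pos, fun w hw ↦ ?_⟩
    obtain ⟨z, hzF, hwz⟩ := mem_iUnion₂.1 (hF hw)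
    have hle : s z ≤ ∑ z ∈ F, s z + 1 :=
      (Finset.single_le_sum (fun z hz ↦ hs0 z (hFZ z hz)) hzF).trans (by simp)
    have := hstab (φ w (s z)) (hN w (hZN w hw).1 ((hZN w hw).2.trans_lt hεN) _
      (hs0 z (hFZ z hzF))) hwz (∑ z ∈ F, s z + 1 - s z) (sub_nonneg.2 hle)
    rwa [hadd, add_sub_cancel] at this
  obtain ⟨T, hT, hunif⟩ := hunif
  have hη : ∃ η > 0, ∀ w ∈ closedBall 0 ε, V w < η → ‖φ w T‖ < ε := by
    set A := closedBall (0 : E) ε ∩ {w | ε ≤ ‖φ w T‖} with hA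
    have hAc : IsCompact A := (isCompact_closedBall 0 ε).inter_right
      (isClosed_le continuous_const (hφx T hT.le).norm)
    rcases A.eq_empty_or_nonempty with hAe | hAne
    · refine ⟨1, one_pos, fun w hw _ ↦ ?_⟩
      by_contra! hcon
      exact (hAe ▸ (⟨hw, hcon⟩ : w ∈ A) : w ∈ (∅ : Set E))
    · obtain ⟨m, hm, hmin⟩ := hAc.exists_isMinOn hAne (hVc.mono (inter_subset_left.trans hsub))
      refine ⟨V m, ?_, fun w hw hlt ↦ ?_⟩
      · refine (hVnonneg m (hsub hm.1)).lt_of_ne' fun h ↦ ?_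
        exact absurd (hunif m ⟨hm.1, h⟩) (not_lt.2 hm.2)
      · by_contra! hcon
        exact absurd (hmin (⟨hw, hcon⟩ : w ∈ A)) (not_le.2 hlt)
  obtain ⟨η, hη, hηT⟩ := hη
  have hVat : ∀ᶠ x in 𝓝 (0 : E), V x < η :=
    (hVc.continuousAt (closedBall_mem_nhds 0 hr)).eventually_lt_const (by rwa [hV0])
  obtain ⟨δ₁, hδ₁, hVδ⟩ := Metric.eventually_nhds_iff.1 hVat
  refine ⟨min δ₁ (ε * Real.exp (-(K * T))), by positivity, fun x hx t ht ↦ ?_⟩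
  have hxV : V x < η := hVδ (by rw [dist_zero_right]; exact hx.trans_le (min_le_left _ _))
  have hshort : ∀ s ∈ Icc 0 T, ‖φ x s‖ < ε := by
    intro s hs
    have h1 := hlip x 0 s hs.1
    rw [hfix, dist_zero_right, dist_zero_right] at h1
    calc ‖φ x s‖ ≤ ‖x‖ * Real.exp (K * s) := h1
      _ ≤ ‖x‖ * Real.exp (K * T) := by gcongr; exact hs.2
      _ < ε * Real.exp (-(K * T)) * Real.exp (K * T) := by
        gcongr; exact hx.trans_le (min_le_right _ _)
      _ = ε := by rw [mul_assoc, ← Real.exp_add]; simp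
  refine lt_of_lt_of_le ?_ hεε₀
  by_contra! hcon
  set B := Ici (0 : ℝ) ∩ {s | ε ≤ ‖φ x s‖} with hB
  have hBc : IsClosed B := isClosed_Ici.inter (isClosed_le continuous_const (hφ x).norm)
  have hBb : BddBelow B := ⟨0, fun s hs ↦ hs.1⟩
  have hτ : sInf B ∈ B := hBc.csInf_mem ⟨t, ht, hcon⟩ hBb
  set τ := sInf B
  have hbefore : ∀ s, 0 ≤ s → s < τ → ‖φ x s‖ < ε := fun s hs hlt ↦ by
    by_contra! hge
    exact absurd (csInf_le hBb (⟨hs, hge⟩ : s ∈ B)) (not_le.2 hlt)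
  have hTτ : T < τ := by
    by_contra! hle
    exact absurd (hshort τ ⟨hτ.1, hle⟩) (not_lt.2 hτ.2)
  have hw : ‖φ x (τ - T)‖ < ε := hbefore _ (by linarith) (by linarith)
  have hVw : V (φ x (τ - T)) ≤ V x := hmono x _ (by linarith) fun s hs ↦
    hsub (mem_closedBall_zero_iff.2 (hbefore s hs.1 (by linarith [hs.2])).le)
  have := hηT _ (mem_closedBall_zero_iff.2 hw.le) (hVw.trans_lt hxV)
  rw [hadd, sub_add_cancel] at this
  exact absurd this (not_lt.2 hτ.2)

/-- Attractivity from a semidefinite Liapunov function: if the origin is stable, and the bounded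
trajectories along which `V` is constant start in a set `N` relative to which the origin is
attractive, then the origin is attractive. -/
theorem attractive_of_semidefinite
    (hadd : ∀ x s t, φ (φ x s) t = φ x (s + t))
    (hφx : ∀ t, 0 ≤ t → Continuous fun x ↦ φ x t)
    (hr : 0 < r) (hVc : ContinuousOn V (closedBall 0 r))
    (hVnonneg : ∀ x ∈ closedBall 0 r, 0 ≤ V x)
    (hmono : ∀ x t, 0 ≤ t → (∀ s ∈ Icc 0 t, φ x s ∈ closedBall 0 r) → V (φ x t) ≤ V x)
    (hE : ∀ w, (∀ t ≥ 0, φ w t ∈ ball 0 r) → (∀ t ≥ 0, V (φ w t) = V w) → w ∈ N)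
    (hstab : ∀ ε > 0, ∃ δ > 0, ∀ x, ‖x‖ < δ → ∀ t ≥ 0, ‖φ x t‖ < ε)
    (hattr : ∃ δ > 0, ∀ z ∈ N, ‖z‖ < δ → Tendsto (φ z) atTop (𝓝 0)) :
    ∃ δ > 0, ∀ x, ‖x‖ < δ → Tendsto (φ x) atTop (𝓝 0) := by
  obtain ⟨δA, hδA, hattr⟩ := hattr
  obtain ⟨ε, hε, hεr, hεA⟩ : ∃ ε > 0, ε < r ∧ ε < δA :=
    ⟨min (r / 2) (δA / 2), by positivity, (min_le_left _ _).trans_lt (by linarith),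
      (min_le_right _ _).trans_lt (by linarith)⟩
  obtain ⟨δ, hδ, hδε⟩ := hstab ε hε
  refine ⟨δ, hδ, fun x hx ↦ ?_⟩
  have hsub : closedBall (0 : E) ε ⊆ ball 0 r := closedBall_subset_ball hεr
  have hin : ∀ t ≥ 0, φ x t ∈ closedBall 0 ε := fun t ht ↦
    mem_closedBall_zero_iff.2 (hδε x hx t ht).le
  have hanti : AntitoneOn (fun t ↦ V (φ x t)) (Ici 0) := by
    intro s hs t _ hst
    have := hmono (φ x s) (t - s) (sub_nonneg.2 hst) fun u hu ↦ by
      rw [hadd]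
      exact ball_subset_closedBall (hsub (hin _ (add_nonneg hs hu.1)))
    rwa [hadd, add_sub_cancel] at this
  obtain ⟨c, hc⟩ : ∃ c, Tendsto (fun t ↦ V (φ x t)) atTop (𝓝 c) := by
    have hanti' : Antitone fun t : ℝ ↦ V (φ x (max t 0)) := fun s t hst ↦
      hanti (le_max_right s 0) (le_max_right t 0) (max_le_max hst le_rfl)
    refine ⟨_, (tendsto_atTop_ciInf hanti' ⟨0, ?_⟩).congr' ?_⟩
    · rintro _ ⟨t, rfl⟩
      exact hVnonneg _ (ball_subset_closedBall (hsub (hin _ (le_max_right t 0))))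
    · filter_upwards [eventually_ge_atTop 0] with t ht
      rw [max_eq_left ht]
  have hclus : ∀ u, MapClusterPt u atTop (φ x) → u ∈ closedBall 0 ε ∧ V u = c := by
    intro u hu
    have hu' : u ∈ closedBall 0 ε := by
      by_contra hcon
      obtain ⟨t, ht, ht0⟩ := ((hu.frequently (isClosed_closedBall.isOpen_compl.mem_nhds
        hcon)).and_eventually (eventually_ge_atTop 0)).exists
      exact ht (hin t ht0)
    refine ⟨hu', ?_⟩
    have hVu : ContinuousAt V u := hVc.continuousAt
      (mem_of_superset (isOpen_ball.mem_nhds (hsub hu')) ball_subset_closedBall)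
    have h1 : MapClusterPt (V u) atTop (fun t ↦ V (φ x t)) := hu.continuousAt_comp hVu
    have : (𝓝 (V u) ⊓ 𝓝 c).NeBot := ClusterPt.mono h1 hc
    exact eq_of_nhds_neBot this
  obtain ⟨w, -, hw⟩ := (isCompact_closedBall (0 : E) ε).exists_mapClusterPt
    (f := atTop) (u := φ x) (tendsto_principal.2 ((eventually_ge_atTop 0).mono hin))
  have hwt : ∀ t ≥ 0, MapClusterPt (φ w t) atTop (φ x) := by
    intro t ht
    have h1 : MapClusterPt (φ w t) atTop (fun s ↦ φ (φ x s) t) :=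
      hw.continuousAt_comp (hφx t ht).continuousAt
    simp only [hadd] at h1
    exact h1.of_comp (tendsto_atTop_add_const_right _ t tendsto_id)
  have hwN : w ∈ N := hE w (fun t ht ↦ hsub (hclus _ (hwt t ht)).1) fun t ht ↦
    (hclus _ (hwt t ht)).2.trans (hclus w hw).2.symm
  have hw0 : Tendsto (φ w) atTop (𝓝 0) := hattr w hwN
    ((mem_closedBall_zero_iff.1 (hclus w hw).1).trans_lt hεA)
  rw [Metric.tendsto_atTop]
  intro ε' hε'
  obtain ⟨δ', hδ', hstab'⟩ := hstab ε' hε'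
  obtain ⟨t, ht, ht0⟩ := ((hw0.norm.eventually_lt_const (by simpa using hδ')).and
    (eventually_ge_atTop 0)).exists
  obtain ⟨s, hs⟩ := ((hwt t ht0).frequently
    (continuous_norm.continuousAt.eventually_lt_const ht)).exists
  refine ⟨s, fun u hu ↦ ?_⟩
  have := hstab' _ hs (u - s) (sub_nonneg.2 hu)
  rwa [hadd, add_sub_cancel, ← dist_zero_right] at this

end Semidefinite

/-- A bounded Lipschitz map into a Euclidean space extends to a bounded Lipschitz map. -/
theorem LipschitzOnWith.exists_bounded_extension {α ι : Type*} [PseudoMetricSpace α] [Fintype ι]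
    {f : α → EuclideanSpace ℝ ι} {s : Set α} {K : NNReal} {M : ℝ} (hf : LipschitzOnWith K f s)
    (hM : ∀ x ∈ s, ‖f x‖ ≤ M) :
    ∃ (K' : NNReal) (C : ℝ) (g : α → EuclideanSpace ℝ ι),
      LipschitzWith K' g ∧ (∀ x, ‖g x‖ ≤ C) ∧ EqOn f g s := by
  obtain ⟨g, hg, hfg⟩ := hf.extend_finite_dimension
  let c : EuclideanSpace ℝ ι → EuclideanSpace ℝ ι := fun v ↦
    WithLp.toLp 2 fun i ↦ max (-|M|) (min |M| (v i))
  have hc : LipschitzWith 1 c := LipschitzWith.of_dist_le_mul fun u v ↦ by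
    rw [NNReal.coe_one, one_mul, EuclideanSpace.dist_eq, EuclideanSpace.dist_eq]
    gcongr with i
    rw [Real.dist_eq, Real.dist_eq]
    exact (abs_max_sub_max_le_max _ _ _ _).trans (by
      simpa using abs_min_sub_min_le_max |M| (u i) |M| (v i))
  refine ⟨_, √(∑ _i : ι, |M| ^ 2), c ∘ g, hc.comp hg, fun x ↦ ?_, fun x hx ↦ ?_⟩
  · rw [EuclideanSpace.norm_eq]
    gcongr with i
    exact abs_le.2 ⟨le_max_left _ _, max_le (by linarith [abs_nonneg M]) (min_le_left _ _)⟩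
  · ext i
    have hi : |f x i| ≤ |M| :=
      ((PiLp.norm_apply_le (f x) i).trans (hM x hx)).trans (le_abs_self M)
    rw [Function.comp_apply, ← hfg hx]
    exact ((congrArg _ (min_eq_right (abs_le.1 hi).2)).trans (max_eq_right (abs_le.1 hi).1)).symm

section Autonomous

variable {n : ℕ} {D : Set (EuclideanSpace ℝ (Fin n))}
  {f : EuclideanSpace ℝ (Fin n) → EuclideanSpace ℝ (Fin n)}

theorem IsSolOnAut.mono {x : ℝ → EuclideanSpace ℝ (Fin n)}
    {D' : Set (EuclideanSpace ℝ (Fin n))} {s s' : Set ℝ} (hx : IsSolOnAut D f x s)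
    (hD : D ⊆ D') (hs : s' ⊆ s) : IsSolOnAut D' f x s' :=
  fun t ht ↦ ⟨hD (hx t (hs ht)).1, (hx t (hs ht)).2⟩

theorem IsSolOnAut.continuousOn {x : ℝ → EuclideanSpace ℝ (Fin n)} {s : Set ℝ}
    (hx : IsSolOnAut D f x s) : ContinuousOn x s :=
  HasDerivAt.continuousOn fun t ht ↦ (hx t ht).2

/-- Solutions of a locally Lipschitz differential equation are determined by their initial
value. -/
theorem IsSolOnAut.eqOn {x y : ℝ → EuclideanSpace ℝ (Fin n)} {a b : ℝ} (hf : LocLipOn D f)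
    (hx : IsSolOnAut D f x (Icc a b)) (hy : IsSolOnAut D f y (Icc a b)) (hxy : x a = y a) :
    EqOn x y (Icc a b) := by
  refine IsClosed.Icc_subset_of_forall_mem_nhdsWithin (s := {t | x t = y t}) ?_ hxy ?_
  · rw [inter_comm]
    exact (hx.continuousOn.prodMk hy.continuousOn).preimage_isClosed_of_isClosed isClosed_Icc
      isClosed_diagonal
  · rintro t ⟨hxyt, htab⟩
    have hxt := hx t (Ico_subset_Icc_self htab)
    have hyt := hy t (Ico_subset_Icc_self htab)
    obtain ⟨ε, hε, L, hL, hlip⟩ := hf (x t) hxt.1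
    have hlip' : LipschitzOnWith L.toNNReal f (D ∩ ball (x t) ε) :=
      LipschitzOnWith.of_dist_le_mul fun u hu v hv ↦ by
        rw [Real.coe_toNNReal L hL, dist_eq_norm, dist_eq_norm]
        exact hlip u hu v hv
    have hev : ∀ᶠ s in 𝓝 t, x s ∈ ball (x t) ε ∧ y s ∈ ball (x t) ε :=
      (hxt.2.continuousAt.eventually_mem (ball_mem_nhds _ hε)).and
        (hyt.2.continuousAt.eventually_mem (hxyt ▸ ball_mem_nhds _ hε))
    obtain ⟨δ, hδ, hball⟩ := Metric.eventually_nhds_iff.1 hev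
    have htc : t < min b (t + δ / 2) := lt_min htab.2 (by linarith)
    have hsub : Icc t (min b (t + δ / 2)) ⊆ Icc a b :=
      Icc_subset_Icc htab.1 (min_le_left _ _)
    have hnear : ∀ s ∈ Icc t (min b (t + δ / 2)), dist s t < δ := fun s hs ↦ by
      rw [Real.dist_eq, abs_of_nonneg (sub_nonneg.2 hs.1)]
      linarith [hs.2.trans (min_le_right _ _)]
    have heq : EqOn x y (Icc t (min b (t + δ / 2))) :=
      ODE_solution_unique_of_mem_Icc_right (v := fun _ ↦ f) (s := fun _ ↦ D ∩ ball (x t) ε)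
        (fun _ _ ↦ hlip') (hx.continuousOn.mono hsub)
        (fun s hs ↦ (hx s (hsub (Ico_subset_Icc_self hs))).2.hasDerivWithinAt)
        (fun s hs ↦ ⟨(hx s (hsub (Ico_subset_Icc_self hs))).1,
          (hball (hnear s (Ico_subset_Icc_self hs))).1⟩) (hy.continuousOn.mono hsub)
        (fun s hs ↦ (hy s (hsub (Ico_subset_Icc_self hs))).2.hasDerivWithinAt)
        (fun s hs ↦ ⟨(hy s (hsub (Ico_subset_Icc_self hs))).1,
          (hball (hnear s (Ico_subset_Icc_self hs))).2⟩) hxyt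
    exact mem_of_superset (Icc_mem_nhdsGT htc) heq

theorem maxPosInvAut_subset {S : Set (EuclideanSpace ℝ (Fin n))} : MaxPosInvAut D f S ⊆ S :=
  sUnion_subset fun _ h ↦ h.1

theorem posInvariantAut_maxPosInvAut {S : Set (EuclideanSpace ℝ (Fin n))} :
    PosInvariantAut D f (MaxPosInvAut D f S) := by
  rintro t₀ t₁ x hx ⟨A, hA, hxA⟩ t ht
  exact ⟨A, hA, hA.2 t₀ t₁ x hx hxA t ht⟩

/-- Asymptotic stability is inherited by positively invariant subsets. -/
theorem AsympStableAut.of_posInvariantAut {N : Set (EuclideanSpace ℝ (Fin n))}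
    (hD : AsympStableAut D f) (hND : N ⊆ D) (hN : PosInvariantAut D f N) :
    AsympStableAut N f := by
  have key : ∀ x : ℝ → EuclideanSpace ℝ (Fin n), x 0 ∈ N → IsSolOnAut D f x (Ici 0) →
      IsSolOnAut N f x (Ici 0) := fun x hx0 hx t ht ↦
    ⟨hN 0 t x (hx.mono Subset.rfl fun s hs ↦ hs.1) hx0 t ⟨ht, le_rfl⟩, (hx t ht).2⟩
  refine ⟨fun ε hε ↦ ?_, ?_⟩
  · obtain ⟨δ, hδ, h⟩ := hD.1 ε hε
    refine ⟨δ, hδ, fun x₀ hx₀ hlt ↦ ?_⟩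
    obtain ⟨x, hx0, hx, hxε⟩ := h x₀ (hND hx₀) hlt
    exact ⟨x, hx0, key x (hx0 ▸ hx₀) hx, hxε⟩
  · obtain ⟨δ, hδ, h⟩ := hD.2
    refine ⟨δ, hδ, fun x₀ hx₀ hlt ↦ ?_⟩
    obtain ⟨x, hx0, hx, hxt⟩ := h x₀ (hND hx₀) hlt
    exact ⟨x, hx0, key x (hx0 ▸ hx₀) hx, hxt⟩

/-- Near an equilibrium, a locally Lipschitz vector field agrees with a bounded and globally
Lipschitz one. -/
theorem LocLipOn.exists_bounded_lipschitzWith (hf : LocLipOn D f) (hD : IsOpen D)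
    (h0 : (0 : EuclideanSpace ℝ (Fin n)) ∈ D) (hf0 : f 0 = 0) :
    ∃ r > 0, closedBall 0 r ⊆ D ∧ ∃ (K : NNReal) (C : ℝ)
      (g : EuclideanSpace ℝ (Fin n) → EuclideanSpace ℝ (Fin n)),
      LipschitzWith K g ∧ (∀ x, ‖g x‖ ≤ C) ∧ EqOn f g (closedBall 0 r) := by
  obtain ⟨ε, hε, L, hL, hlip⟩ := hf 0 h0
  obtain ⟨r, hr, hsub⟩ := Metric.nhds_basis_closedBall.mem_iff.1
    (inter_mem (hD.mem_nhds h0) (ball_mem_nhds 0 hε))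
  refine ⟨r, hr, hsub.trans inter_subset_left, LipschitzOnWith.exists_bounded_extension
    (K := L.toNNReal) (M := L * r) (LipschitzOnWith.of_dist_le_mul fun u hu v hv ↦ ?_)
    fun x hx ↦ ?_⟩
  · rw [Real.coe_toNNReal L hL, dist_eq_norm, dist_eq_norm]
    exact hlip u (hsub hu) v (hsub hv)
  · have := hlip x (hsub hx) 0 (hsub (mem_closedBall_self hr.le))
    rw [hf0, sub_zero, sub_zero] at this
    exact this.trans (by gcongr; exact mem_closedBall_zero_iff.1 hx)

variable {V : EuclideanSpace ℝ (Fin n) → ℝ}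

theorem IsSolOnAut.hasDerivAt_comp {x : ℝ → EuclideanSpace ℝ (Fin n)} {s : Set ℝ} {t : ℝ}
    (hx : IsSolOnAut D f x s) (hD : IsOpen D) (hV : ContDiffOn ℝ 1 V D) (ht : t ∈ s) :
    HasDerivAt (fun t ↦ V (x t)) (fderiv ℝ V (x t) (f (x t))) t :=
  ((hV.contDiffAt (hD.mem_nhds (hx t ht).1)).differentiableAt
    one_ne_zero).hasFDerivAt.comp_hasDerivAt t (hx t ht).2

/-- A function with nonpositive orbital derivative is nonincreasing along solutions. -/
theorem IsSolOnAut.antitoneOn_comp {x : ℝ → EuclideanSpace ℝ (Fin n)} {a b : ℝ}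
    (hx : IsSolOnAut D f x (Icc a b)) (hD : IsOpen D) (hV : ContDiffOn ℝ 1 V D)
    (hVf : ∀ x ∈ D, fderiv ℝ V x (f x) ≤ 0) : AntitoneOn (fun t ↦ V (x t)) (Icc a b) := by
  refine antitoneOn_of_deriv_nonpos (convex_Icc a b)
    (HasDerivAt.continuousOn fun t ht ↦ hx.hasDerivAt_comp hD hV ht) ?_ ?_ <;>
  intro t ht <;> have ht := interior_subset ht
  · exact (hx.hasDerivAt_comp hD hV ht).differentiableAt.differentiableWithinAt
  · rw [(hx.hasDerivAt_comp hD hV ht).deriv]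
    exact hVf _ (hx t ht).1

/-- The zeros of a nonnegative function with nonpositive orbital derivative form a positively
invariant set. -/
theorem posInvariantAut_setOf_eq_zero (hD : IsOpen D) (hV : ContDiffOn ℝ 1 V D)
    (hVnonneg : ∀ x ∈ D, 0 ≤ V x) (hVf : ∀ x ∈ D, fderiv ℝ V x (f x) ≤ 0) :
    PosInvariantAut D f {x ∈ D | V x = 0} := by
  intro t₀ t₁ x hx h0 t ht
  refine ⟨(hx t ht).1, le_antisymm ?_ (hVnonneg _ (hx t ht).1)⟩
  exact (hx.antitoneOn_comp hD hV hVf ⟨le_rfl, ht.1.trans ht.2⟩ ht ht.1).trans_eq h0.2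

/-- The forward orbit of a solution defined for all positive times is positively invariant. -/
theorem posInvariantAut_image_Ici {x : ℝ → EuclideanSpace ℝ (Fin n)} (hf : LocLipOn D f)
    (hx : IsSolOnAut D f x (Ici 0)) : PosInvariantAut D f (x '' Ici 0) := by
  rintro t₀ t₁ y hy ⟨a, ha, hay⟩ t ht
  have hz : IsSolOnAut D f (fun s ↦ x (s + (a - t₀))) (Icc t₀ t₁) := fun s hs ↦ by
    have hs' : s + (a - t₀) ∈ Ici 0 := by
      have := hs.1
      simp only [mem_Ici] at ha ⊢
      linarith
    exact ⟨(hx _ hs').1, (hx _ hs').2.comp_add_const s (a - t₀)⟩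
  have heq := hy.eqOn hf hz (by simpa using hay.symm) ht
  refine ⟨t + (a - t₀), ?_, heq.symm⟩
  have := ht.1
  simp only [mem_Ici] at ha ⊢
  linarith

/-- If the zeros of the output near the origin are controlled by a semidefinite Liapunov function,
asymptotic stability relative to the maximal positively invariant set in the kernel of the output
implies asymptotic stability. -/
theorem AsympStableAut.of_maxPosInvAut {E : Set (EuclideanSpace ℝ (Fin n))}
    (hN : AsympStableAut (MaxPosInvAut D f E) f) (hED : E ⊆ D) (hD : IsOpen D)
    (h0 : (0 : EuclideanSpace ℝ (Fin n)) ∈ D) (hf : LocLipOn D f) (hf0 : f 0 = 0)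
    (hV : ContDiffOn ℝ 1 V D) (hVnonneg : ∀ x ∈ D, 0 ≤ V x) (hV0 : V 0 = 0)
    (hVf : ∀ x ∈ D, fderiv ℝ V x (f x) ≤ 0) (hVE : ∀ x ∈ D, fderiv ℝ V x (f x) = 0 → x ∈ E) :
    AsympStableAut D f := by
  set N := MaxPosInvAut D f E with hNdef
  have hND : N ⊆ D := maxPosInvAut_subset.trans hED
  obtain ⟨r, hr, hrD, K, C, g, hgK, hgC, hfg⟩ := hf.exists_bounded_lipschitzWith hD h0 hf0
  obtain ⟨φ, hφ0, hφd, hadd, hlip⟩ := exists_flow_of_lipschitz_of_bounded hgK hgC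
  have hφc : ∀ x, Continuous (φ x) := fun x ↦
    continuous_iff_continuousAt.2 fun t ↦ (hφd x t).continuousAt
  have hφx : ∀ t, 0 ≤ t → Continuous fun x ↦ φ x t := fun t ht ↦
    (LipschitzWith.of_dist_le_mul (K := (Real.exp (K * t)).toNNReal) fun x y ↦ by
      rw [Real.coe_toNNReal _ (Real.exp_pos _).le, mul_comm]; exact hlip x y t ht).continuous
  have hfix : ∀ t, φ 0 t = 0 := fun t ↦ by
    have hg0 : g 0 = 0 := (hfg (mem_closedBall_self hr.le)).symm.trans hf0
    refine congrFun (ODE_solution_unique_univ (v := fun _ ↦ g) (s := fun _ ↦ univ) (t₀ := 0)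
      (f := φ 0) (g := fun _ ↦ 0) (fun _ ↦ hgK.lipschitzOnWith) (fun t ↦ ⟨hφd _ t, trivial⟩)
      (fun t ↦ ⟨?_, trivial⟩) (hφ0 0)) t
    rw [hg0]
    exact hasDerivAt_const t 0
  have hsol : ∀ x (s : Set ℝ), (∀ t ∈ s, φ x t ∈ closedBall 0 r) → IsSolOnAut D f (φ x) s :=
    fun x s hs t ht ↦ ⟨hrD (hs t ht), by rw [hfg (hs t ht)]; exact hφd x t⟩
  have hmono : ∀ x t, 0 ≤ t → (∀ s ∈ Icc 0 t, φ x s ∈ closedBall 0 r) → V (φ x t) ≤ V x := by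
    intro x t ht hs
    have := (hsol x _ hs).antitoneOn_comp hD hV hVf ⟨le_rfl, ht⟩ ⟨ht, le_rfl⟩ ht
    simpa only [hφ0] using this
  have hVc : ContinuousOn V (closedBall 0 r) := hV.continuousOn.mono hrD
  have hVnn : ∀ x ∈ closedBall 0 r, 0 ≤ V x := fun x hx ↦ hVnonneg x (hrD hx)
  have hZ : ∀ z ∈ closedBall 0 r, V z = 0 → z ∈ N := by
    intro z hz hVz
    refine ⟨{x ∈ D | V x = 0}, ⟨fun x hx ↦ hVE x hx.1 ?_,
      posInvariantAut_setOf_eq_zero hD hV hVnonneg hVf⟩, hrD hz, hVz⟩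
    have hmin : IsLocalMin V x := by
      filter_upwards [hD.mem_nhds hx.1] with y hy
      rw [hx.2]
      exact hVnonneg y hy
    simp [hmin.fderiv_eq_zero]
  have hNstab : ∀ ε > 0, ∃ δ > 0, ∀ z ∈ N, ‖z‖ < δ → ∀ t ≥ 0,
      φ z t ∈ N ∧ ‖φ z t‖ < min ε r := by
    intro ε hε
    obtain ⟨δ, hδ, h⟩ := hN.1 (min ε r) (lt_min hε hr)
    refine ⟨δ, hδ, fun z hz hzδ t ht ↦ ?_⟩
    obtain ⟨y, hy0, hy, hyε⟩ := h z hz hzδ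
    have hyg : ∀ s ∈ Icc 0 t, HasDerivAt y (g (y s)) s := fun s hs ↦ by
      rw [← hfg (mem_closedBall_zero_iff.2 ((hyε s hs.1).le.trans (min_le_right _ _)))]
      exact (hy s hs.1).2
    have heq := ODE_solution_unique (v := fun _ ↦ g) (f := y) (g := φ z) (a := 0) (b := t)
      (fun _ ↦ hgK) (HasDerivAt.continuousOn hyg)
      (fun s hs ↦ (hyg s (Ico_subset_Icc_self hs)).hasDerivWithinAt)
      (hφc z).continuousOn (fun s _ ↦ (hφd z s).hasDerivWithinAt) (hy0.trans (hφ0 z).symm)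
      ⟨ht, le_rfl⟩
    rw [← heq]
    exact ⟨(hy t ht).1, hyε t ht⟩
  have hNinv : ∃ δ > 0, ∀ z ∈ N, ‖z‖ < δ → ∀ t ≥ 0, φ z t ∈ N := by
    obtain ⟨δ, hδ, h⟩ := hNstab r hr
    exact ⟨δ, hδ, fun z hz hzδ t ht ↦ (h z hz hzδ t ht).1⟩
  have hNst : ∀ ε > 0, ∃ δ > 0, ∀ z ∈ N, ‖z‖ < δ → ∀ t ≥ 0, ‖φ z t‖ < ε := by
    intro ε hε
    obtain ⟨δ, hδ, h⟩ := hNstab ε hε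
    exact ⟨δ, hδ, fun z hz hzδ t ht ↦ (h z hz hzδ t ht).2.trans_le (min_le_left _ _)⟩
  have hNattr : ∃ δ > 0, ∀ z ∈ N, ‖z‖ < δ → Tendsto (φ z) atTop (𝓝 0) := by
    obtain ⟨δ, hδ, h⟩ := hNinv
    obtain ⟨δ₁, hδ₁, hst⟩ := hNst r hr
    obtain ⟨δ₂, hδ₂, hat⟩ := hN.2
    refine ⟨min δ₁ δ₂, lt_min hδ₁ hδ₂, fun z hz hlt ↦ ?_⟩
    obtain ⟨y, hy0, hy, hyt⟩ := hat z hz (hlt.trans_le (min_le_right _ _))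
    refine hyt.congr' ?_
    filter_upwards [eventually_ge_atTop 0] with t ht
    refine (hy.mono hND fun s hs ↦ hs.1 : IsSolOnAut D f y (Icc 0 t)).eqOn hf
      (hsol z _ fun s hs ↦ ?_) (hy0.trans (hφ0 z).symm) ⟨ht, le_rfl⟩
    exact mem_closedBall_zero_iff.2 (hst z hz (hlt.trans_le (min_le_left _ _)) s hs.1).le
  have hE : ∀ w, (∀ t ≥ 0, φ w t ∈ ball 0 r) → (∀ t ≥ 0, V (φ w t) = V w) → w ∈ N := by
    intro w hw hVw
    have hws : IsSolOnAut D f (φ w) (Ici 0) :=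
      hsol w _ fun t ht ↦ ball_subset_closedBall (hw t ht)
    refine ⟨φ w '' Ici 0, ⟨?_, posInvariantAut_image_Ici hf hws⟩, 0, self_mem_Ici, hφ0 w⟩
    rintro _ ⟨t, ht, rfl⟩
    refine hVE _ (hws t ht).1 ?_
    refine (uniqueDiffOn_Ici (0 : ℝ) t ht).eq_deriv _
      (hws.hasDerivAt_comp hD hV ht).hasDerivWithinAt
      ((hasDerivWithinAt_const t _ (V w)).congr hVw (hVw t ht))
  have hstab := stable_of_semidefinite hφc hadd hφx hlip K.2 hfix hr hVc hVnn hV0 hmono hZ hNinv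
    hNst hNattr
  have hattr := attractive_of_semidefinite hadd hφx hr hVc hVnn hmono hE hstab hNattr
  obtain ⟨δr, hδr, hstr⟩ := hstab r hr
  have hglob : ∀ x, ‖x‖ < δr → IsSolOnAut D f (φ x) (Ici 0) := fun x hx ↦
    hsol x _ fun t ht ↦ mem_closedBall_zero_iff.2 (hstr x hx t ht).le
  refine ⟨fun ε hε ↦ ?_, ?_⟩
  · obtain ⟨δ, hδ, hst⟩ := hstab ε hε
    exact ⟨min δ δr, lt_min hδ hδr, fun x _ hx ↦ ⟨φ x, hφ0 x,
      hglob x (hx.trans_le (min_le_right _ _)), hst x (hx.trans_le (min_le_left _ _))⟩⟩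
  · obtain ⟨δ, hδ, hat⟩ := hattr
    exact ⟨min δ δr, lt_min hδ hδr, fun x _ hx ↦ ⟨φ x, hφ0 x,
      hglob x (hx.trans_le (min_le_right _ _)), hat x (hx.trans_le (min_le_left _ _))⟩⟩

end Autonomous

/-- Theorem 3 of the paper: for the inputless system `ẋ = f x`,
`y = h x`, if the nonlinear Liapunov inequality `∇V · f + ‖h‖^q ≤ 0` has a nonnegative
`C¹` solution `V` with `V 0 = 0`, then `(h, f)` is strongly zero-state detectable iff the
origin is an asymptotically stable equilibrium of `ẋ = f x`. -/
theorem strongZSD_iff_asympStable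
    {n p : ℕ} (D : Set (EuclideanSpace ℝ (Fin n))) (hDopen : IsOpen D)
    (hDconn : IsConnected D) (h0D : (0 : EuclideanSpace ℝ (Fin n)) ∈ D)
    (f : EuclideanSpace ℝ (Fin n) → EuclideanSpace ℝ (Fin n)) (hf : LocLipOn D f)
    (hf0 : f 0 = 0)
    (h : EuclideanSpace ℝ (Fin n) → EuclideanSpace ℝ (Fin p)) (hh : ContinuousOn h D)
    (hh0 : h 0 = 0)
    (q : ℝ) (hq : 0 < q)
    (V : EuclideanSpace ℝ (Fin n) → ℝ) (hV : ContDiffOn ℝ 1 V D)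
    (hVnonneg : ∀ x ∈ D, 0 ≤ V x) (hV0 : V 0 = 0)
    (hLiap : ∀ x ∈ D, fderiv ℝ V x (f x) + ‖h x‖ ^ q ≤ 0) :
    StrongZSD D f h ↔ AsympStableAut D f := by
  have hVf : ∀ x ∈ D, fderiv ℝ V x (f x) ≤ 0 := fun x hx ↦ by
    linarith [hLiap x hx, Real.rpow_nonneg (norm_nonneg (h x)) q]
  have hVE : ∀ x ∈ D, fderiv ℝ V x (f x) = 0 → x ∈ {x ∈ D | h x = 0} := by
    intro x hx hz
    have hle := hLiap x hx
    rw [hz, zero_add] at hle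
    have hpow := hle.antisymm (Real.rpow_nonneg (norm_nonneg (h x)) q)
    exact ⟨hx, norm_eq_zero.1 ((Real.rpow_eq_zero (norm_nonneg _) hq.ne').1 hpow)⟩
  exact ⟨fun hN ↦ AsympStableAut.of_maxPosInvAut hN (sep_subset _ _) hDopen h0D hf hf0 hV hVnonneg
      hV0 hVf hVE,
    fun hA ↦ hA.of_posInvariantAut (maxPosInvAut_subset.trans (sep_subset _ _))
      posInvariantAut_maxPosInvAut⟩
end
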